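/- arXiv:2110.03985 — 3 statements merged into one kernel-verified Lean document; each statement's English description precedes it below -/
import Mathlib

section
/- Let n ≥ 2 be an integer and let H > (n-1)/n be a real number. Define φ(x) = sinh(x)^(n-1) − n·H·I_{n-1}(x). Then φ is strictly increasing on the interval [0, artanh((n-1)/(nH))] and strictly decreasing on the interval [artanh((n-1)/(nH)), ∞); in particular artanh((n-1)/(nH)) is the unique strictly positive critical point of φ. -/
/-- `I_m(t) = ∫₀^t sinh(τ)^m dτ`. -/
noncomputable def Ifun (m : ℕ) (t : ℝ) : ℝ := ∫ τ in (0:ℝ)..t, Real.sinh τ ^ m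

/-- Inverse hyperbolic tangent: `artanh x = (1/2)·log((1+x)/(1-x))`. -/
noncomputable def artanh (x : ℝ) : ℝ := (1 / 2) * Real.log ((1 + x) / (1 - x))

theorem artanh_eq_real_artanh {x : ℝ} (hx : x ∈ Set.Ioo (-1) 1) : artanh x = Real.artanh x := by
  rw [artanh, Real.artanh_eq_half_log (Set.Ioo_subset_Icc_self hx)]

theorem strictMono_tanh : StrictMono Real.tanh := fun x y hxy => by
  rwa [← Real.artanh_lt_artanh_iff ⟨Real.neg_one_lt_tanh x, Real.tanh_lt_one x⟩
    ⟨Real.neg_one_lt_tanh y, Real.tanh_lt_one y⟩, Real.artanh_tanh, Real.artanh_tanh]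

theorem hasDerivAt_Ifun (m : ℕ) (x : ℝ) : HasDerivAt (Ifun m) (Real.sinh x ^ m) x := by
  have hc : Continuous fun τ : ℝ => Real.sinh τ ^ m := Real.continuous_sinh.pow m
  exact intervalIntegral.integral_hasDerivAt_right (hc.intervalIntegrable _ _)
    (hc.stronglyMeasurableAtFilter _ _) hc.continuousAt

theorem hasDerivAt_sinh_pow_sub_mul_Ifun (n : ℕ) (hn : 2 ≤ n) (H : ℝ) (hH : H ≠ 0) (x : ℝ) :
    HasDerivAt (fun x : ℝ => Real.sinh x ^ (n - 1) - (n : ℝ) * H * Ifun (n - 1) x)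
      ((n : ℝ) * H * Real.sinh x ^ (n - 2) * Real.cosh x *
        (((n : ℝ) - 1) / ((n : ℝ) * H) - Real.tanh x)) x := by
  obtain ⟨k, rfl⟩ := Nat.exists_eq_add_of_le' hn
  have h := ((Real.hasDerivAt_sinh x).pow (k + 1)).sub
    ((hasDerivAt_Ifun (k + 1) x).const_mul (((k + 2 : ℕ) : ℝ) * H))
  refine h.congr_deriv ?_
  have hc := (Real.cosh_pos x).ne'
  have hk : ((k + 2 : ℕ) : ℝ) ≠ 0 := by positivity
  rw [Real.tanh_eq_sinh_div_cosh]
  simp only [Nat.add_sub_cancel]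
  field_simp
  push_cast
  ring

/-- For `n ≥ 2`, `H > (n-1)/n`, the function `φ(x) = sinh(x)^(n-1) − n·H·I_{n-1}(x)` is
strictly increasing on `[0, artanh((n-1)/(nH))]`, strictly decreasing on
`[artanh((n-1)/(nH)), ∞)`, and `artanh((n-1)/(nH))` is its unique positive critical point. -/
theorem statement2 (n : ℕ) (hn : 2 ≤ n) (H : ℝ) (hH : H > ((n : ℝ) - 1) / n) :
    StrictMonoOn (fun x : ℝ => Real.sinh x ^ (n - 1) - (n : ℝ) * H * Ifun (n - 1) x)
        (Set.Icc 0 (artanh (((n : ℝ) - 1) / ((n : ℝ) * H)))) ∧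
    StrictAntiOn (fun x : ℝ => Real.sinh x ^ (n - 1) - (n : ℝ) * H * Ifun (n - 1) x)
        (Set.Ici (artanh (((n : ℝ) - 1) / ((n : ℝ) * H)))) ∧
    ∀ x : ℝ, 0 < x →
      (deriv (fun x : ℝ => Real.sinh x ^ (n - 1) - (n : ℝ) * H * Ifun (n - 1) x) x = 0 ↔
        x = artanh (((n : ℝ) - 1) / ((n : ℝ) * H))) := by
  have hn' : (2 : ℝ) ≤ n := by exact_mod_cast hn
  have hH0 : 0 < H := lt_trans (div_pos (by linarith) (by linarith)) hH
  have hnH : 0 < (n : ℝ) * H := by positivity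
  have hd := hasDerivAt_sinh_pow_sub_mul_Ifun n hn H hH0.ne'
  set φ : ℝ → ℝ := fun x => Real.sinh x ^ (n - 1) - (n : ℝ) * H * Ifun (n - 1) x
  set q : ℝ := ((n : ℝ) - 1) / ((n : ℝ) * H)
  have hq : q ∈ Set.Ioo 0 1 := by
    refine ⟨div_pos (by linarith) hnH, (div_lt_one hnH).2 ?_⟩
    rwa [gt_iff_lt, div_lt_iff₀ (by linarith), mul_comm] at hH
  have hq' : q ∈ Set.Ioo (-1) 1 := ⟨by linarith [hq.1], hq.2⟩
  rw [artanh_eq_real_artanh hq']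
  have ha : 0 < Real.artanh q := Real.artanh_pos hq
  have hcoef : ∀ x : ℝ, 0 < x → 0 < (n : ℝ) * H * Real.sinh x ^ (n - 2) * Real.cosh x :=
    fun x hx => mul_pos (mul_pos hnH (pow_pos (Real.sinh_pos_iff.2 hx) _)) (Real.cosh_pos x)
  have hcont : Continuous φ := continuous_iff_continuousAt.2 fun x => (hd x).continuousAt
  have hlt : ∀ x, x < Real.artanh q → Real.tanh x < q := fun x hx => by
    simpa only [Real.tanh_artanh hq'] using strictMono_tanh hx
  have hgt : ∀ x, Real.artanh q < x → q < Real.tanh x := fun x hx => by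
    simpa only [Real.tanh_artanh hq'] using strictMono_tanh hx
  refine ⟨?_, ?_, fun x hx => ?_⟩
  · refine strictMonoOn_of_deriv_pos (convex_Icc _ _) hcont.continuousOn fun x hx => ?_
    rw [interior_Icc] at hx
    rw [(hd x).deriv]
    exact mul_pos (hcoef x hx.1) (sub_pos.2 (hlt x hx.2))
  · refine strictAntiOn_of_deriv_neg (convex_Ici _) hcont.continuousOn fun x hx => ?_
    rw [interior_Ici] at hx
    rw [(hd x).deriv]
    exact mul_neg_of_pos_of_neg (hcoef x (ha.trans hx)) (sub_neg.2 (hgt x hx))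
  · rw [(hd x).deriv, mul_eq_zero_iff_left (hcoef x hx).ne', sub_eq_zero]
    constructor
    · intro h
      rw [h, Real.artanh_tanh]
    · rintro rfl
      exact (Real.tanh_artanh hq').symm
end

section
/- Let n ≥ 2 be an integer and let r₀ : ℝ → ℝ be a function such that for every d < 0, r₀(d) > 0 and sinh(r₀(d))^(n-1) + (n-1)·I_{n-1}(r₀(d)) + d = 0. Then r₀(d)/|d|^(1/(n-1)) tends to 1 as d tends to 0 from the left. In particular r₀(d) tends to 0 as d tends to 0 from the left. -/
theorem Ifun_nonneg (m : ℕ) {t : ℝ} (ht : 0 ≤ t) : 0 ≤ Ifun m t :=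
  intervalIntegral.integral_nonneg ht fun _ hx => pow_nonneg (Real.sinh_nonneg_iff.2 hx.1) m

theorem Ifun_le_mul_sinh_pow (m : ℕ) {t : ℝ} (ht : 0 ≤ t) : Ifun m t ≤ t * Real.sinh t ^ m := by
  have h : Ifun m t ≤ ∫ _ in (0 : ℝ)..t, Real.sinh t ^ m := by
    refine intervalIntegral.integral_mono_on ht ?_ intervalIntegrable_const fun x hx => ?_
    · exact (Real.continuous_sinh.pow m).intervalIntegrable _ _
    · exact pow_le_pow_left₀ (Real.sinh_nonneg_iff.2 hx.1) (Real.sinh_le_sinh.2 hx.2) m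
  simpa using h

theorem sinh_le_mul_cosh {t : ℝ} (ht : 0 < t) : Real.sinh t ≤ t * Real.cosh t := by
  obtain ⟨c, hc, h⟩ := exists_hasDerivAt_eq_slope Real.sinh Real.cosh ht
    Real.continuous_sinh.continuousOn fun x _ => Real.hasDerivAt_sinh x
  have hle : Real.cosh c ≤ Real.cosh t := by
    rw [Real.cosh_le_cosh, abs_of_pos hc.1, abs_of_pos ht]
    exact hc.2.le
  rw [h, Real.sinh_zero, sub_zero, sub_zero, div_le_iff₀ ht] at hle
  linarith

/-- Two-sided bounds on the `m`-th root of `sinh(t)^m + m·I_m(t)`. -/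
theorem le_rpow_and_rpow_le {m : ℕ} (hm : m ≠ 0) {t : ℝ} (ht : 0 < t) :
    t ≤ (Real.sinh t ^ m + m * Ifun m t) ^ ((1 : ℝ) / m) ∧
      (Real.sinh t ^ m + m * Ifun m t) ^ ((1 : ℝ) / m) ≤ t * (Real.cosh t * (1 + t)) := by
  have hs : 0 ≤ Real.sinh t := Real.sinh_nonneg_iff.2 ht.le
  have hI : 0 ≤ m * Ifun m t := mul_nonneg m.cast_nonneg (Ifun_nonneg m ht.le)
  have root {x : ℝ} (hx : 0 ≤ x) : (x ^ m) ^ ((1 : ℝ) / m) = x := by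
    rw [one_div, Real.pow_rpow_inv_natCast hx hm]
  constructor
  · calc t ≤ Real.sinh t := Real.self_le_sinh_iff.2 ht.le
      _ = (Real.sinh t ^ m) ^ ((1 : ℝ) / m) := (root hs).symm
      _ ≤ _ := Real.rpow_le_rpow (by positivity) (by linarith) (by positivity)
  · have hB : 1 + m * t ≤ (1 + t) ^ m := one_add_mul_le_pow (by linarith) m
    calc (Real.sinh t ^ m + m * Ifun m t) ^ ((1 : ℝ) / m)
        ≤ ((Real.sinh t * (1 + t)) ^ m) ^ ((1 : ℝ) / m) := by
          refine Real.rpow_le_rpow (by positivity) ?_ (by positivity)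
          calc Real.sinh t ^ m + m * Ifun m t
              ≤ Real.sinh t ^ m + m * (t * Real.sinh t ^ m) := by
                gcongr
                exact Ifun_le_mul_sinh_pow m ht.le
            _ = Real.sinh t ^ m * (1 + m * t) := by ring
            _ ≤ Real.sinh t ^ m * (1 + t) ^ m := by gcongr
            _ = _ := (mul_pow _ _ _).symm
      _ = Real.sinh t * (1 + t) := root (by positivity)
      _ ≤ t * Real.cosh t * (1 + t) := by
          gcongr
          exact sinh_le_mul_cosh ht
      _ = _ := mul_assoc _ _ _

/-- For `n ≥ 2` and `r₀(d) = r_{0,d}` the positive solution of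
`sinh(ρ)^(n-1) + (n-1)·I_{n-1}(ρ) + d = 0`, the ratio `r₀(d)/|d|^(1/(n-1))` tends to `1`
as `d → 0⁻`; in particular `r₀(d) → 0` as `d → 0⁻`. -/
theorem statement13 (n : ℕ) (hn : 2 ≤ n) (r₀ : ℝ → ℝ)
    (h₀ : ∀ d : ℝ, d < 0 → 0 < r₀ d ∧
      Real.sinh (r₀ d) ^ (n - 1) + ((n : ℝ) - 1) * Ifun (n - 1) (r₀ d) + d = 0) :
    Filter.Tendsto (fun d : ℝ => r₀ d / |d| ^ ((1 : ℝ) / ((n : ℝ) - 1)))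
        (nhdsWithin 0 (Set.Iio 0)) (nhds 1) ∧
    Filter.Tendsto r₀ (nhdsWithin 0 (Set.Iio 0)) (nhds 0) := by
  obtain ⟨m, rfl⟩ : ∃ m, n = m + 1 := ⟨n - 1, by omega⟩
  have hm : m ≠ 0 := by omega
  simp only [Nat.add_sub_cancel, Nat.cast_add, Nat.cast_one, add_sub_cancel_right] at h₀ ⊢
  have hbd {d : ℝ} (hd : d < 0) : 0 < r₀ d ∧ r₀ d ≤ |d| ^ ((1 : ℝ) / m) ∧
      |d| ^ ((1 : ℝ) / m) ≤ r₀ d * (Real.cosh (r₀ d) * (1 + r₀ d)) := by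
    obtain ⟨hr, heq⟩ := h₀ d hd
    have habs : |d| = Real.sinh (r₀ d) ^ m + m * Ifun m (r₀ d) := by
      rw [abs_of_neg hd]
      linarith
    rw [habs]
    exact ⟨hr, le_rpow_and_rpow_le hm hr⟩
  have hzero : Filter.Tendsto r₀ (nhdsWithin 0 (Set.Iio 0)) (nhds 0) := by
    have hroot : Filter.Tendsto (fun d : ℝ => |d| ^ ((1 : ℝ) / m))
        (nhdsWithin 0 (Set.Iio 0)) (nhds 0) := by
      have hpos : (0 : ℝ) < 1 / m := by positivity
      have hc : Continuous fun d : ℝ => |d| ^ ((1 : ℝ) / m) :=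
        continuous_abs.rpow_const fun _ => Or.inr hpos.le
      simpa [Real.zero_rpow hpos.ne', hm] using (hc.tendsto 0).mono_left nhdsWithin_le_nhds
    refine squeeze_zero' ?_ ?_ hroot <;> filter_upwards [self_mem_nhdsWithin] with d hd
    · exact (hbd hd).1.le
    · exact (hbd hd).2.1
  refine ⟨?_, hzero⟩
  have hlow : Filter.Tendsto (fun d => (Real.cosh (r₀ d) * (1 + r₀ d))⁻¹)
      (nhdsWithin 0 (Set.Iio 0)) (nhds 1) := by
    have hc : Continuous fun t : ℝ => Real.cosh t * (1 + t) := by fun_prop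
    simpa using ((hc.tendsto 0).comp hzero).inv₀ (by simp)
  refine tendsto_of_tendsto_of_tendsto_of_le_of_le' hlow tendsto_const_nhds ?_ ?_ <;>
    filter_upwards [self_mem_nhdsWithin] with d hd <;> obtain ⟨hr, hle, hge⟩ := hbd hd
  · have hpos : 0 < Real.cosh (r₀ d) * (1 + r₀ d) :=
      mul_pos (Real.cosh_pos _) (by linarith)
    rwa [le_div_iff₀ (hr.trans_le hle), inv_mul_le_iff₀ hpos, mul_comm]
  · exact div_le_one_of_le₀ hle (hr.le.trans hle)
end

section
/- Let n ≥ 2 be an integer and let H > (n-1)/n be a real number, and let R_C > 0 be the unique positive solution of cosh(ρ)^(n-1) = n·H·J_{n-1}(ρ). Define μ_{H,0}(ρ) = ∫₀^ρ nH·J_{n-1}(t)/√(cosh(t)^(2n-2) − (nH·J_{n-1}(t))²) dt for 0 ≤ ρ < R_C. Then μ_{H,0} is strictly increasing and convex on [0, R_C). -/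
/-- `J_m(t) = ∫₀^t cosh(τ)^m dτ`. -/
noncomputable def Jfun (m : ℕ) (t : ℝ) : ℝ := ∫ τ in (0:ℝ)..t, Real.cosh τ ^ m

/-- The generating curve `μ_{H,0}` of the horizontal CMC `H` cylinder. -/
noncomputable def mu (n : ℕ) (H ρ : ℝ) : ℝ :=
  ∫ t in (0:ℝ)..ρ,
    (n : ℝ) * H * Jfun (n - 1) t /
      Real.sqrt (Real.cosh t ^ (2 * n - 2) - ((n : ℝ) * H * Jfun (n - 1) t) ^ 2)

theorem hasDerivAt_Jfun (m : ℕ) (t : ℝ) : HasDerivAt (Jfun m) (Real.cosh t ^ m) t := by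
  have hc : Continuous fun τ : ℝ => Real.cosh τ ^ m := by fun_prop
  exact hc.integral_hasStrictDerivAt 0 t |>.hasDerivAt

theorem continuous_Jfun (m : ℕ) : Continuous (Jfun m) :=
  continuous_iff_continuousAt.2 fun t => (hasDerivAt_Jfun m t).continuousAt

theorem Jfun_zero (m : ℕ) : Jfun m 0 = 0 := by simp [Jfun]

theorem Jfun_strictMono (m : ℕ) : StrictMono (Jfun m) :=
  strictMono_of_hasDerivAt_pos (hasDerivAt_Jfun m) fun t => pow_pos (Real.cosh_pos t) m

/-- If `c * J_m = cosh ^ m` has no solution on `(0, R)`, then `c * J_m < cosh ^ m` on `[0, R)`. -/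
theorem mul_Jfun_lt_cosh_pow {m : ℕ} {c R : ℝ}
    (h : ∀ s, 0 < s → s < R → Real.cosh s ^ m ≠ c * Jfun m s) {t : ℝ} (ht : t ∈ Set.Ico 0 R) :
    c * Jfun m t < Real.cosh t ^ m := by
  by_contra! hle
  have hcont : ContinuousOn (fun s => c * Jfun m s - Real.cosh s ^ m) (Set.Icc 0 t) := by
    have := continuous_Jfun m
    fun_prop
  obtain ⟨s, hs, hs0⟩ := intermediate_value_Icc ht.1 hcont
    (show (0 : ℝ) ∈ Set.Icc _ _ by simp [Jfun_zero, hle])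
  have hs0 : c * Jfun m s - Real.cosh s ^ m = 0 := hs0
  have hpos : 0 < s := by
    refine hs.1.lt_of_ne fun h0 => ?_
    simp [← h0, Jfun_zero] at hs0
  exact h s hpos (hs.2.trans_lt ht.2) (by linarith)

/-- The quotient `c * J_m / cosh ^ m` is monotone as long as it stays below `1`, if `m ≤ c`. -/
theorem monotoneOn_mul_Jfun_div_cosh_pow {m : ℕ} {c R : ℝ} (hc : (m : ℝ) ≤ c)
    (h : ∀ t ∈ Set.Ico 0 R, c * Jfun m t < Real.cosh t ^ m) :
    MonotoneOn (fun t => c * Jfun m t / Real.cosh t ^ m) (Set.Ico 0 R) := by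
  have hd (t : ℝ) := ((hasDerivAt_Jfun m t).const_mul c).div ((Real.hasDerivAt_cosh t).pow m)
    (pow_pos (Real.cosh_pos t) m).ne'
  have hc0 : 0 ≤ c := (Nat.cast_nonneg m).trans hc
  refine monotoneOn_of_deriv_nonneg (convex_Ico 0 R)
    (fun t _ => (hd t).continuousAt.continuousWithinAt)
    (fun t _ => (hd t).differentiableAt.differentiableWithinAt) fun t ht => ?_
  rw [interior_Ico] at ht
  refine (hd t).deriv.symm ▸ div_nonneg ?_ (sq_nonneg _)
  have hJ : 0 ≤ Jfun m t := Jfun_zero m ▸ (Jfun_strictMono m).monotone ht.1.le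
  have hC := Real.cosh_pos t
  have hS : 0 ≤ Real.sinh t := Real.sinh_nonneg_iff.2 ht.1.le
  rcases m with _ | k
  · simpa using hc0
  have hJt : ((k + 1 : ℕ) : ℝ) * Jfun (k + 1) t ≤ Real.cosh t ^ (k + 1) :=
    (mul_le_mul_of_nonneg_right hc hJ).trans (h t (Set.Ioo_subset_Ico_self ht)).le
  have hkey : ((k + 1 : ℕ) : ℝ) * Jfun (k + 1) t * Real.sinh t
      ≤ Real.cosh t ^ (k + 1) * Real.cosh t :=
    mul_le_mul hJt (Real.sinh_lt_cosh t).le hS (by positivity)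
  have hmul := mul_le_mul_of_nonneg_left hkey (mul_nonneg hc0 (pow_nonneg hC.le k))
  simp only [Nat.add_sub_cancel, Pi.pow_apply]
  rw [sub_nonneg]
  calc _ = c * Real.cosh t ^ k * (((k + 1 : ℕ) : ℝ) * Jfun (k + 1) t * Real.sinh t) := by ring
    _ ≤ _ := hmul
    _ = _ := by ring

theorem div_sqrt_sq_sub_sq_le {a b a' b' : ℝ} (ha : 0 ≤ a) (hab : a < b) (ha' : 0 ≤ a')
    (hab' : a' < b') (h : a / b ≤ a' / b') :
    a / Real.sqrt (b ^ 2 - a ^ 2) ≤ a' / Real.sqrt (b' ^ 2 - a' ^ 2) := by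
  have h1 : 0 < b ^ 2 - a ^ 2 := by nlinarith
  have h2 : 0 < b' ^ 2 - a' ^ 2 := by nlinarith
  rw [div_le_div_iff₀ (by linarith) (by linarith)] at h
  rw [div_le_div_iff₀ (Real.sqrt_pos.2 h1) (Real.sqrt_pos.2 h2)]
  have hb : 0 ≤ b' := ha'.trans hab'.le
  have hsq := pow_le_pow_left₀ (mul_nonneg ha hb) h 2
  refine le_of_sq_le_sq ?_ (by positivity)
  rw [mul_pow, mul_pow, Real.sq_sqrt h1.le, Real.sq_sqrt h2.le]
  nlinarith

/-- For `n ≥ 2`, `H > (n-1)/n`, with `R_C` the unique positive solution of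
`cosh(ρ)^(n-1) = n·H·J_{n-1}(ρ)`, the function `μ_{H,0}` is strictly increasing and
convex on `[0, R_C)`. -/
theorem statement18 (n : ℕ) (hn : 2 ≤ n) (H : ℝ) (hH : H > ((n : ℝ) - 1) / n)
    (RC : ℝ) (hRC : 0 < RC)
    (heq : Real.cosh RC ^ (n - 1) = (n : ℝ) * H * Jfun (n - 1) RC)
    (huniq : ∀ ρ : ℝ, 0 < ρ →
      Real.cosh ρ ^ (n - 1) = (n : ℝ) * H * Jfun (n - 1) ρ → ρ = RC) :
    StrictMonoOn (mu n H) (Set.Ico 0 RC) ∧ ConvexOn ℝ (Set.Ico 0 RC) (mu n H) := by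
  have hn0 : (0 : ℝ) < n := by positivity
  have hc : ((n - 1 : ℕ) : ℝ) < n * H := by
    rw [gt_iff_lt, div_lt_iff₀ hn0] at hH
    push_cast [Nat.cast_sub (show 1 ≤ n by omega)]
    linarith
  have hc0 : 0 < (n : ℝ) * H := (Nat.cast_nonneg _).trans_lt hc
  have hlt : ∀ t ∈ Set.Ico 0 RC, (n : ℝ) * H * Jfun (n - 1) t < Real.cosh t ^ (n - 1) :=
    fun t ht => mul_Jfun_lt_cosh_pow (fun s hs hsR he => hsR.ne (huniq s hs he)) ht
  have hnonneg : ∀ t ∈ Set.Ico 0 RC, 0 ≤ (n : ℝ) * H * Jfun (n - 1) t := fun t ht =>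
    mul_nonneg hc0.le (Jfun_zero (n - 1) ▸ (Jfun_strictMono (n - 1)).monotone ht.1)
  have hpow (t : ℝ) : Real.cosh t ^ (2 * n - 2) = (Real.cosh t ^ (n - 1)) ^ 2 := by
    rw [← pow_mul]
    congr 1
    omega
  have hrad : ∀ t ∈ Set.Ico 0 RC,
      0 < Real.cosh t ^ (2 * n - 2) - ((n : ℝ) * H * Jfun (n - 1) t) ^ 2 := fun t ht => by
    rw [hpow, sub_pos]
    exact pow_lt_pow_left₀ (hlt t ht) (hnonneg t ht) two_ne_zero
  have hJ := continuous_Jfun (n - 1)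
  let g : ℝ → ℝ := fun t => (n : ℝ) * H * Jfun (n - 1) t /
    Real.sqrt (Real.cosh t ^ (2 * n - 2) - ((n : ℝ) * H * Jfun (n - 1) t) ^ 2)
  have hnum : Continuous fun t => (n : ℝ) * H * Jfun (n - 1) t := by fun_prop
  have hden : Continuous fun t =>
      Real.sqrt (Real.cosh t ^ (2 * n - 2) - ((n : ℝ) * H * Jfun (n - 1) t) ^ 2) := by fun_prop
  have hg : ∀ t ∈ Set.Ico 0 RC, ContinuousAt g t := fun t ht =>
    hnum.continuousAt.div hden.continuousAt (Real.sqrt_pos.2 (hrad t ht)).ne'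
  have hgm : Measurable g := hnum.measurable.div hden.measurable
  have hmono : MonotoneOn g (Set.Ico 0 RC) := fun s hs t ht hst => by
    simp only [g, hpow]
    exact div_sqrt_sq_sub_sq_le (hnonneg s hs) (hlt s hs) (hnonneg t ht) (hlt t ht)
      (monotoneOn_mul_Jfun_div_cosh_pow hc.le hlt hs ht hst)
  have hderiv : ∀ t ∈ Set.Ico 0 RC, HasDerivAt (mu n H) (g t) t := fun t ht => by
    refine intervalIntegral.integral_hasDerivAt_right ?_
      hgm.stronglyMeasurable.stronglyMeasurableAtFilter (hg t ht)
    refine ContinuousOn.intervalIntegrable fun s hs => ?_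
    rw [Set.uIcc_of_le ht.1] at hs
    exact (hg s ⟨hs.1, hs.2.trans_lt ht.2⟩).continuousWithinAt
  have hcont : ContinuousOn (mu n H) (Set.Ico 0 RC) := fun t ht =>
    (hderiv t ht).continuousAt.continuousWithinAt
  have hsub : interior (Set.Ico 0 RC) ⊆ Set.Ico 0 RC := interior_subset
  constructor
  · refine strictMonoOn_of_deriv_pos (convex_Ico 0 RC) hcont fun t ht => ?_
    rw [(hderiv t (hsub ht)).deriv]
    have ht0 : 0 < t := by
      rw [interior_Ico] at ht
      exact ht.1
    exact div_pos (mul_pos hc0 (Jfun_zero (n - 1) ▸ Jfun_strictMono (n - 1) ht0))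
      (Real.sqrt_pos.2 (hrad t (hsub ht)))
  · exact MonotoneOn.convexOn_of_deriv (convex_Ico 0 RC) hcont
      (fun t ht => (hderiv t (hsub ht)).differentiableAt.differentiableWithinAt)
      ((hmono.mono hsub).congr fun t ht => (hderiv t (hsub ht)).deriv.symm)
end
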